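/- arXiv:1104.1024 — 4 statements merged into one kernel-verified Lean document; each statement's English description precedes it below -/
import Mathlib

section
/- For every n ≥ 1 and every vertex x = (x₁…x_n) ∈ Σ_n of the graph G_n, the degree of x in G_n (with a loop contributing 2) equals deg_n(x) = 2 + S(x)·deg(x_n), where S(x) = Σ_{r=0}^{ℓ(x)−1} Π_{j=1}^{r} deg(x_{n−j}) (the empty product being 1) and deg denotes degree in the base graph G. -/
noncomputable section
attribute [local instance] Classical.propDecidable

namespace HierGraph

open Finset MeasureTheory ProbabilityTheory

variable {N : ℕ}

/-- The degree of a vertex in a finite simple graph. -/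
def degH {α : Type*} [Fintype α] (H : SimpleGraph α) (v : α) : ℕ :=
  (univ.filter fun w => H.Adj v w).card

/-- The length `|x ∧ y|` of the longest common prefix of two words. -/
def prefixLen {n : ℕ} (x y : Fin n → Fin N) : ℕ :=
  (univ.filter fun i : Fin n => ∀ j : Fin n, j ≤ i → x j = y j).card

/-- The postfix of `x` starting at position `k` has constant type
(`t = true` ↔ all its letters lie in `V1`). -/
def postfixType (V1 : Finset (Fin N)) {n : ℕ} (k : ℕ) (x : Fin n → Fin N) (t : Bool) : Prop :=
  ∀ i : Fin n, k ≤ i.val → (x i ∈ V1 ↔ t = true)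

/-- The edge relation of the graph `Gₙ` (loops included): `x = y`, or the two postfixes
after the common prefix have types `{1,2}` and corresponding letters are adjacent in `G`. -/
def EdgeRel (G : SimpleGraph (Fin N)) (V1 : Finset (Fin N)) {n : ℕ} (x y : Fin n → Fin N) :
    Prop :=
  x = y ∨
    ((∃ t : Bool, postfixType V1 (prefixLen x y) x t ∧ postfixType V1 (prefixLen x y) y (!t)) ∧
      ∀ i : Fin n, prefixLen x y ≤ i.val → G.Adj (x i) (y i))

/-- The degree of a vertex of `Gₙ`, the loop counting `2`. -/
def degGn (G : SimpleGraph (Fin N)) (V1 : Finset (Fin N)) {n : ℕ} (x : Fin n → Fin N) : ℕ :=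
  2 + (univ.filter fun y : Fin n → Fin N => y ≠ x ∧ EdgeRel G V1 x y).card

/-- `ℓ(x)`: the length of the longest suffix of `x` of constant (nonzero) type. -/
def ell (V1 : Finset (Fin N)) {n : ℕ} (x : Fin n → Fin N) : ℕ :=
  ((Finset.Icc 1 n).filter fun i =>
    (∀ j : Fin n, n - i ≤ j.val → x j ∈ V1) ∨ ∀ j : Fin n, n - i ≤ j.val → x j ∉ V1).sup id

/-- `S(x) = Σ_{r=0}^{ℓ(x)-1} Π_{j=1}^{r} deg(x_{n-j})`. -/
def Sx (G : SimpleGraph (Fin N)) (V1 : Finset (Fin N)) {n : ℕ} (hn : 0 < n)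
    (x : Fin n → Fin N) : ℕ :=
  ∑ r ∈ Finset.range (ell V1 x), ∏ j ∈ Finset.Icc 1 r, degH G (x ⟨n - 1 - j, by omega⟩)

/-- The simple graph `Gₙ` (loops removed). -/
def GnSimple (G : SimpleGraph (Fin N)) (V1 : Finset (Fin N)) (n : ℕ) :
    SimpleGraph (Fin n → Fin N) :=
  SimpleGraph.fromRel (EdgeRel G V1)

/-- The diameter of a finite graph: the maximal graph distance. -/
def fdiam {α : Type*} [Fintype α] (H : SimpleGraph α) : ℕ :=
  univ.sup fun p : α × α => H.dist p.1 p.2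

/-- The number of maximal constant-type blocks of the postfix of `x` starting at
position `k` (`k < n`). -/
def blockCount (V1 : Finset (Fin N)) {n : ℕ} (k : ℕ) (x : Fin n → Fin N) : ℕ :=
  1 + (univ.filter fun i : Fin n =>
        k ≤ i.val ∧ ∃ h : i.val + 1 < n, ¬((x i ∈ V1) ↔ x ⟨i.val + 1, h⟩ ∈ V1)).card

/-- The left endpoint of the `N`-adic interval `I_x`. -/
def Ipt {n : ℕ} (x : Fin n → Fin N) : ℝ := ∑ r : Fin n, (x r : ℝ) / (N : ℝ) ^ (r.val + 1)

/-- The `N`-adic interval `I_x ⊆ [0,1]`. -/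
def Iset {n : ℕ} (x : Fin n → Fin N) : Set ℝ := Set.Icc (Ipt x) (Ipt x + 1 / (N : ℝ) ^ n)

/-- The level-`n` square `Q_{(x,y)} = I_x × I_y`. -/
def Qset {n : ℕ} (x y : Fin n → Fin N) : Set (ℝ × ℝ) := Iset x ×ˢ Iset y

/-- `Λₙ`: the embedded adjacency matrix of `Gₙ` in the unit square. -/
def Lam (G : SimpleGraph (Fin N)) (V1 : Finset (Fin N)) (n : ℕ) : Set (ℝ × ℝ) :=
  ⋃ (p : (Fin n → Fin N) × (Fin n → Fin N)) (_ : EdgeRel G V1 p.1 p.2), Qset p.1 p.2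

/-- `Λ = ⋂_{n ≥ 1} Λₙ`. -/
def LamInf (G : SimpleGraph (Fin N)) (V1 : Finset (Fin N)) : Set (ℝ × ℝ) :=
  ⋂ (n : ℕ) (_ : 1 ≤ n), Lam G V1 n

/-- The homothety `f_v(a,b) = ((a,b) + v)/N` for `v ∈ Σ₁ × Σ₁`. -/
def fmap (N : ℕ) (v : Fin N × Fin N) : ℝ × ℝ → ℝ × ℝ :=
  fun p => ((p.1 + (v.1 : ℝ)) / N, (p.2 + (v.2 : ℝ)) / N)

/-- `f_v = f_{v₁} ∘ ⋯ ∘ f_{vₙ}` for a word `v` over `Σ₁ × Σ₁` (identity for the empty word). -/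
def fpath {n : ℕ} (v : Fin n → Fin N × Fin N) : ℝ × ℝ → ℝ × ℝ :=
  (List.ofFn fun i => fmap N (v i)).foldr (· ∘ ·) id

/-- The unit square `[0,1]²`. -/
def unitSq : Set (ℝ × ℝ) := Set.Icc (0 : ℝ) 1 ×ˢ Set.Icc (0 : ℝ) 1

/-- The diagonal `{(t,t) : t ∈ [0,1]}`. -/
def DiagSet : Set (ℝ × ℝ) := (fun t : ℝ => (t, t)) '' Set.Icc (0 : ℝ) 1

/-- `V_dd`, the diagonal vertices of the directed graph `𝒢`. -/
def Vdd (v : Fin N × Fin N) : Prop := v.1 = v.2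

/-- `V₁₂`, vertices of `𝒢` coming from edges of `G` directed from `V₁` to `V₂`. -/
def V12 (G : SimpleGraph (Fin N)) (V1 : Finset (Fin N)) (v : Fin N × Fin N) : Prop :=
  v.1 ∈ V1 ∧ v.2 ∉ V1 ∧ G.Adj v.1 v.2

/-- `V₂₁`, vertices of `𝒢` coming from edges of `G` directed from `V₂` to `V₁`. -/
def V21 (G : SimpleGraph (Fin N)) (V1 : Finset (Fin N)) (v : Fin N × Fin N) : Prop :=
  v.1 ∉ V1 ∧ v.2 ∈ V1 ∧ G.Adj v.1 v.2

/-- Vertices of the directed graph `𝒢`. -/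
def calGVert (G : SimpleGraph (Fin N)) (V1 : Finset (Fin N)) (v : Fin N × Fin N) : Prop :=
  Vdd v ∨ V12 G V1 v ∨ V21 G V1 v

/-- Directed edges of `𝒢`: all pairs (loops included) within each of `V_dd`, `V₁₂`, `V₂₁`,
plus one edge from each vertex of `V_dd` to each vertex of `V₁₂ ∪ V₂₁`. -/
def calGEdge (G : SimpleGraph (Fin N)) (V1 : Finset (Fin N)) (u v : Fin N × Fin N) : Prop :=
  (Vdd u ∧ Vdd v) ∨ (V12 G V1 u ∧ V12 G V1 v) ∨ (V21 G V1 u ∧ V21 G V1 v) ∨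
    (Vdd u ∧ (V12 G V1 v ∨ V21 G V1 v))

/-- `v ∈ 𝒫ₙ`: `v` is a directed path of length `n` in `𝒢`. -/
def IsPathCalG (G : SimpleGraph (Fin N)) (V1 : Finset (Fin N)) {n : ℕ}
    (v : Fin n → Fin N × Fin N) : Prop :=
  (∀ i, calGVert G V1 (v i)) ∧
    ∀ i j : Fin n, (j : ℕ) = (i : ℕ) + 1 → calGEdge G V1 (v i) (v j)

/-- Non-loop edges of `Gₙ`, i.e. edges of `G'ₙ`. -/
def GnEdge' (G : SimpleGraph (Fin N)) (V1 : Finset (Fin N)) {n : ℕ} (x y : Fin n → Fin N) :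
    Prop :=
  x ≠ y ∧ EdgeRel G V1 x y

/-- The extra edges `RE(Ĝₙ)`: the two words agree except in the last letter, and the last
letters form an extra edge (an edge of `R`). -/
def REn (R : SimpleGraph (Fin N)) {n : ℕ} (x y : Fin n → Fin N) : Prop :=
  ∃ h : 0 < n, (∀ i : Fin n, i.val + 1 < n → x i = y i) ∧
    R.Adj (x ⟨n - 1, Nat.sub_lt h Nat.one_pos⟩) (y ⟨n - 1, Nat.sub_lt h Nat.one_pos⟩)

/-- Adjacency in `Ĝₙ`. -/
def hatAdj (G R : SimpleGraph (Fin N)) (V1 : Finset (Fin N)) {n : ℕ} (x y : Fin n → Fin N) :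
    Prop :=
  GnEdge' G V1 x y ∨ REn R x y

/-- The graph `Ĝₙ`. -/
def HatGn (G R : SimpleGraph (Fin N)) (V1 : Finset (Fin N)) (n : ℕ) :
    SimpleGraph (Fin n → Fin N) :=
  SimpleGraph.fromRel (hatAdj G R V1)

/-- Property R: every `x ∈ Σ₁` lies in a triangle having two edges in `E(G)` and
one extra edge (an edge of `R`). -/
def PropertyR (G R : SimpleGraph (Fin N)) : Prop :=
  ∀ x : Fin N, ∃ y z : Fin N,
    (G.Adj x y ∧ G.Adj x z ∧ R.Adj y z) ∨ (G.Adj x y ∧ R.Adj x z ∧ G.Adj y z) ∨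
      (R.Adj x y ∧ G.Adj x z ∧ G.Adj y z)

/-- Exactly two of the three edges of the triangle `(x,y,z)` are non-loop edges of `Gₙ`. -/
def exactlyTwoG (G : SimpleGraph (Fin N)) (V1 : Finset (Fin N)) {n : ℕ}
    (x y z : Fin n → Fin N) : Prop :=
  (GnEdge' G V1 x y ∧ GnEdge' G V1 x z ∧ ¬GnEdge' G V1 y z) ∨
    (GnEdge' G V1 x y ∧ ¬GnEdge' G V1 x z ∧ GnEdge' G V1 y z) ∨
      (¬GnEdge' G V1 x y ∧ GnEdge' G V1 x z ∧ GnEdge' G V1 y z)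

/-- `Δₙ¹(x)` (counted over ordered pairs): class-1 regular triangles at `x` in `Ĝₙ`. -/
def numTri1 (G R : SimpleGraph (Fin N)) (V1 : Finset (Fin N)) {n : ℕ} (x : Fin n → Fin N) :
    ℕ :=
  (univ.filter fun p : (Fin n → Fin N) × (Fin n → Fin N) =>
    GnEdge' G V1 x p.1 ∧ GnEdge' G V1 x p.2 ∧ REn R p.1 p.2).card

/-- `Δₙ²(x)` (counted over ordered pairs): class-2 regular triangles at `x` in `Ĝₙ`. -/
def numTri2 (G R : SimpleGraph (Fin N)) (V1 : Finset (Fin N)) {n : ℕ} (x : Fin n → Fin N) :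
    ℕ :=
  (univ.filter fun p : (Fin n → Fin N) × (Fin n → Fin N) =>
    GnEdge' G V1 x p.1 ∧ REn R x p.2 ∧ GnEdge' G V1 p.1 p.2).card

/-- `Δₙ^{ir}(x)` (counted over ordered pairs): irregular triangles at `x` in `Ĝₙ`. -/
def numTriIr (G R : SimpleGraph (Fin N)) (V1 : Finset (Fin N)) {n : ℕ} (x : Fin n → Fin N) :
    ℕ :=
  (univ.filter fun p : (Fin n → Fin N) × (Fin n → Fin N) =>
    hatAdj G R V1 x p.1 ∧ hatAdj G R V1 x p.2 ∧ hatAdj G R V1 p.1 p.2 ∧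
      ¬exactlyTwoG G V1 x p.1 p.2).card

/-- Exactly two of the three edges of the triangle `(x,y,z)` are edges of `G`. -/
def exactlyTwoB (G : SimpleGraph (Fin N)) (x y z : Fin N) : Prop :=
  (G.Adj x y ∧ G.Adj x z ∧ ¬G.Adj y z) ∨ (G.Adj x y ∧ ¬G.Adj x z ∧ G.Adj y z) ∨
    (¬G.Adj x y ∧ G.Adj x z ∧ G.Adj y z)

/-- `Δ¹(z)` (counted over ordered pairs): class-1 regular triangles at `z` in `Ĝ = G ⊔ R`. -/
def numTri1B (G R : SimpleGraph (Fin N)) (z : Fin N) : ℕ :=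
  (univ.filter fun p : Fin N × Fin N => G.Adj z p.1 ∧ G.Adj z p.2 ∧ R.Adj p.1 p.2).card

/-- `Δ²(z)` (counted over ordered pairs): class-2 regular triangles at `z` in `Ĝ = G ⊔ R`. -/
def numTri2B (G R : SimpleGraph (Fin N)) (z : Fin N) : ℕ :=
  (univ.filter fun p : Fin N × Fin N => G.Adj z p.1 ∧ R.Adj z p.2 ∧ G.Adj p.1 p.2).card

/-- `Δ^{ir}(z)` (counted over ordered pairs): irregular triangles at `z` in `Ĝ = G ⊔ R`. -/
def numTriIrB (G R : SimpleGraph (Fin N)) (z : Fin N) : ℕ :=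
  (univ.filter fun p : Fin N × Fin N =>
    (G ⊔ R).Adj z p.1 ∧ (G ⊔ R).Adj z p.2 ∧ (G ⊔ R).Adj p.1 p.2 ∧
      ¬exactlyTwoB G z p.1 p.2).card

/-- The number of ordered pairs of neighbors of `x` that are adjacent,
i.e. twice the number of triangles containing `x`. -/
def triOrd {α : Type*} [Fintype α] (H : SimpleGraph α) (x : α) : ℕ :=
  (univ.filter fun p : α × α => H.Adj x p.1 ∧ H.Adj x p.2 ∧ H.Adj p.1 p.2).card

/-- The local clustering coefficient
`C_x = #{edges between neighbors of x} / (deg x choose 2)`. -/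
def clustering {α : Type*} [Fintype α] (H : SimpleGraph α) (x : α) : ℝ :=
  (triOrd H x : ℝ) / ((degH H x : ℝ) * ((degH H x : ℝ) - 1))

/-- The degree of vertex `i` in the random graph `Gₙʳ` built from the digit variables `D`
(neighbors `j ≠ i` are counted). -/
def degR (G : SimpleGraph (Fin N)) (V1 : Finset (Fin N)) {n M : ℕ} {Ω : Type*}
    (D : Fin M → Fin n → Ω → Fin N) (i : Fin M) (ω : Ω) : ℕ :=
  (univ.filter fun j : Fin M => j ≠ i ∧
    EdgeRel G V1 (fun k => D i k ω) (fun k => D j k ω)).card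

/-- `t_k = (d₁^{k+1} - 1)/(d₁ - 1) + 1`. -/
def tkD (d₁ k : ℕ) : ℝ := ((d₁ : ℝ) ^ (k + 1) - 1) / ((d₁ : ℝ) - 1) + 1

theorem prefixLen_eq {n : ℕ} {x y : Fin n → Fin N} (k : Fin n)
    (hlt : ∀ i < k, x i = y i) (hk : x k ≠ y k) : prefixLen x y = k.val := by
  have h : (univ.filter fun i : Fin n => ∀ j : Fin n, j ≤ i → x j = y j) = Finset.Iio k := by
    ext i
    simp only [mem_filter, mem_univ, true_and, Finset.mem_Iio]
    refine ⟨fun h => ?_, fun hi j hj => hlt j (lt_of_le_of_lt hj hi)⟩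
    by_contra hc
    exact hk (h k (not_lt.mp hc))
  rw [prefixLen, h, Fin.card_Iio]

theorem exists_prefixLen_eq {n : ℕ} {x y : Fin n → Fin N} (h : x ≠ y) :
    ∃ k : Fin n, (∀ i < k, x i = y i) ∧ prefixLen x y = k.val := by
  obtain ⟨i, hi⟩ := Function.ne_iff.mp h
  obtain ⟨k, hk, hmin⟩ := WellFounded.has_min (wellFounded_lt (α := Fin n)) {i | x i ≠ y i} ⟨i, hi⟩
  have hlt : ∀ j < k, x j = y j := fun j hj => by
    by_contra hc
    exact hmin j hc hj
  exact ⟨k, hlt, prefixLen_eq k hlt hk⟩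

theorem lt_ell_iff (V1 : Finset (Fin N)) {n : ℕ} (x : Fin n → Fin N) (r : ℕ) :
    r < ell V1 x ↔ r < n ∧ ((∀ j : Fin n, n - 1 - r ≤ j.val → x j ∈ V1) ∨
      ∀ j : Fin n, n - 1 - r ≤ j.val → x j ∉ V1) := by
  rw [ell, Finset.lt_sup_iff]
  simp only [mem_filter, Finset.mem_Icc, id]
  constructor
  · rintro ⟨i, ⟨⟨_, hi⟩, h⟩, hr⟩
    refine ⟨by omega, h.imp ?_ ?_⟩ <;> exact fun h j hj => h j (by omega)
  · rintro ⟨hr, h⟩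
    refine ⟨r + 1, ⟨⟨by omega, by omega⟩, h.imp ?_ ?_⟩, by omega⟩ <;>
      exact fun h j hj => h j (by omega)

/-- The words agreeing with `x` except on the last `r + 1` letters, where they are
letterwise adjacent to `x`. -/
def suffixNeighbors (G : SimpleGraph (Fin N)) {n : ℕ} (x : Fin n → Fin N) (r : ℕ) :
    Finset (Fin n → Fin N) :=
  Fintype.piFinset fun i => if i.val < n - 1 - r then {x i} else univ.filter fun w => G.Adj (x i) w

theorem mem_suffixNeighbors {G : SimpleGraph (Fin N)} {n : ℕ} {x y : Fin n → Fin N} {r : ℕ} :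
    y ∈ suffixNeighbors G x r ↔ (∀ i : Fin n, i.val < n - 1 - r → x i = y i) ∧
      ∀ i : Fin n, n - 1 - r ≤ i.val → G.Adj (x i) (y i) := by
  rw [suffixNeighbors, Fintype.mem_piFinset]
  constructor
  · intro h
    refine ⟨fun i hi => ?_, fun i hi => ?_⟩
    · have := h i
      rw [if_pos hi, mem_singleton] at this
      exact this.symm
    · have := h i
      rw [if_neg (by omega)] at this
      exact (mem_filter.mp this).2
  · rintro ⟨h₁, h₂⟩ i
    split_ifs with hi
    · exact mem_singleton.mpr (h₁ i hi).symm
    · exact mem_filter.mpr ⟨mem_univ _, h₂ i (by omega)⟩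

theorem prefixLen_of_mem_suffixNeighbors {G : SimpleGraph (Fin N)} {n : ℕ}
    {x y : Fin n → Fin N} {r : ℕ} (hn : 0 < n) (h : y ∈ suffixNeighbors G x r) :
    prefixLen x y = n - 1 - r := by
  rw [mem_suffixNeighbors] at h
  exact prefixLen_eq ⟨n - 1 - r, by omega⟩ (fun i hi => h.1 i hi) (h.2 _ le_rfl).ne

theorem card_suffixNeighbors (G : SimpleGraph (Fin N)) {n : ℕ} (hn : 0 < n)
    (x : Fin n → Fin N) {r : ℕ} (hr : r < n) :
    (suffixNeighbors G x r).card = (∏ j ∈ Finset.Icc 1 r, degH G (x ⟨n - 1 - j, by omega⟩)) *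
      degH G (x ⟨n - 1, by omega⟩) := by
  let D : ℕ → ℕ := fun j => degH G (x ⟨n - 1 - j, by omega⟩)
  have hprod : (suffixNeighbors G x r).card = ∏ i ∈ range n, if i < r + 1 then D i else 1 := by
    rw [suffixNeighbors, Fintype.card_piFinset, ← Fin.prod_univ_eq_prod_range,
      ← Equiv.prod_comp Fin.revPerm]
    refine Finset.prod_congr rfl fun i _ => ?_
    have hi := i.isLt
    simp only [Fin.revPerm_apply, Fin.val_rev]
    have hrev : Fin.rev i = ⟨n - 1 - i, by omega⟩ := Fin.ext (by simp only [Fin.val_rev]; omega)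
    by_cases h : i.val < r + 1
    · rw [if_neg (by omega), if_pos h, hrev]
      rfl
    · rw [if_pos (by omega), if_neg h, card_singleton]
  have hfilter : (range n).filter (· < r + 1) = range (r + 1) := by
    ext i
    simp only [mem_filter, mem_range]
    omega
  rw [hprod, ← Finset.prod_filter, hfilter, Finset.prod_range_eq_mul_Ico _ (by omega), mul_comm]
  rfl

theorem neighbors_eq_biUnion (G : SimpleGraph (Fin N)) (V1 : Finset (Fin N))
    (hbip : ∀ a b : Fin N, G.Adj a b → (a ∈ V1 ↔ b ∉ V1))
    {n : ℕ} (hn : 0 < n) (x : Fin n → Fin N) :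
    (univ.filter fun y : Fin n → Fin N => y ≠ x ∧ EdgeRel G V1 x y) =
      (range (ell V1 x)).biUnion (suffixNeighbors G x) := by
  ext y
  simp only [mem_filter, mem_univ, true_and, mem_biUnion, mem_range, lt_ell_iff]
  constructor
  · rintro ⟨hne, rfl | ⟨⟨t, ht, -⟩, hadj⟩⟩
    · exact absurd rfl hne
    obtain ⟨k, hlt, hk⟩ := exists_prefixLen_eq (Ne.symm hne)
    rw [hk] at ht hadj
    have hkn := k.isLt
    have hsub : n - 1 - (n - 1 - k.val) = k.val := by omega
    refine ⟨n - 1 - k, ⟨by omega, ?_⟩, ?_⟩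
    · rw [hsub]
      cases t with
      | true => exact Or.inl fun j hj => (ht j hj).mpr rfl
      | false => exact Or.inr fun j hj hm => Bool.false_ne_true ((ht j hj).mp hm)
    · rw [mem_suffixNeighbors, hsub]
      exact ⟨fun i hi => hlt i hi, hadj⟩
  · rintro ⟨r, ⟨hr, htype⟩, hy⟩
    have hlen := prefixLen_of_mem_suffixNeighbors hn hy
    obtain ⟨-, hadj⟩ := mem_suffixNeighbors.mp hy
    refine ⟨?_, Or.inr ⟨?_, hlen ▸ hadj⟩⟩
    · rintro rfl
      exact (hadj ⟨n - 1, by omega⟩ (Nat.sub_le _ _)).ne rfl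
    · unfold postfixType
      rw [hlen]
      rcases htype with h | h
      · refine ⟨true, fun i hi => by simp [h i hi], fun i hi => ?_⟩
        have := hbip _ _ (hadj i hi)
        simp [this.mp (h i hi)]
      · refine ⟨false, fun i hi => by simp [h i hi], fun i hi => ?_⟩
        have := hbip _ _ (hadj i hi)
        simpa [h i hi] using this

/-- `deg_n(x) = 2 + S(x)·deg(x_n)`. -/
theorem statement0 {N : ℕ} (G : SimpleGraph (Fin N)) (V1 : Finset (Fin N))
    (hV1 : V1.Nonempty) (hV2 : V1ᶜ.Nonempty)
    (hbip : ∀ a b : Fin N, G.Adj a b → (a ∈ V1 ↔ b ∉ V1))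
    {n : ℕ} (hn : 0 < n) (x : Fin n → Fin N) :
    degGn G V1 x = 2 + Sx G V1 hn x * degH G (x ⟨n - 1, by omega⟩) := by
  rw [degGn, neighbors_eq_biUnion G V1 hbip hn x, Finset.card_biUnion, Sx, Finset.sum_mul]
  · congr 1
    refine Finset.sum_congr rfl fun r hr => ?_
    rw [mem_range, lt_ell_iff] at hr
    exact card_suffixNeighbors G hn x hr.1
  · intro r hr s hs hrs
    rw [mem_coe, mem_range, lt_ell_iff] at hr hs
    refine Finset.disjoint_left.mpr fun y hyr hys => hrs ?_
    have h₁ := prefixLen_of_mem_suffixNeighbors hn hyr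
    have h₂ := prefixLen_of_mem_suffixNeighbors hn hys
    omega

end HierGraph
end
end

section
/- For every n ≥ 1, a pair ((x₁…x_n),(y₁…y_n)) ∈ Σ_n × Σ_n is an edge of G_n if and only if the sequence ((x₁,y₁),(x₂,y₂),…,(x_n,y_n)) is an element of 𝒫_n, i.e. each (x_i,y_i) is a vertex of the directed graph 𝒢 and ((x_i,y_i),(x_{i+1},y_{i+1})) is a directed edge of 𝒢 for all 1 ≤ i < n. -/
noncomputable section
attribute [local instance] Classical.propDecidable

namespace HierGraph

open Finset MeasureTheory ProbabilityTheory

variable {N : ℕ}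

theorem lt_prefixLen_iff {n : ℕ} (x y : Fin n → Fin N) (i : Fin n) :
    i.val < prefixLen x y ↔ ∀ j : Fin n, j ≤ i → x j = y j := by
  constructor
  · intro h
    by_contra hi
    have hsub : (univ.filter fun i : Fin n => ∀ j : Fin n, j ≤ i → x j = y j) ⊆ Finset.Iio i := by
      intro a ha
      rw [Finset.mem_filter] at ha
      rw [Finset.mem_Iio]
      by_contra hai
      exact hi fun j hj => ha.2 j (hj.trans (not_lt.mp hai))
    have hcard := Finset.card_le_card hsub
    rw [Fin.card_Iio] at hcard
    exact absurd h (not_lt.mpr hcard)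
  · intro h
    have hsub : Finset.Iic i ⊆ univ.filter fun i : Fin n => ∀ j : Fin n, j ≤ i → x j = y j := by
      intro a ha
      rw [Finset.mem_Iic] at ha
      exact Finset.mem_filter.mpr ⟨Finset.mem_univ a, fun j hj => h j (hj.trans ha)⟩
    have hcard := Finset.card_le_card hsub
    rw [Fin.card_Iic] at hcard
    exact hcard

/-- A property inherited along consecutive indices holds from any index on which it holds. -/
theorem forall_ge_of_step {n : ℕ} {P : Fin n → Prop}
    (hstep : ∀ i j : Fin n, (j : ℕ) = (i : ℕ) + 1 → P i → P j) {i : Fin n} (hi : P i)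
    (j : Fin n) (hij : i.val ≤ j.val) : P j := by
  obtain ⟨m, hm⟩ := j
  induction m with
  | zero => exact (Fin.ext (Nat.le_zero.mp hij) : i = ⟨0, hm⟩) ▸ hi
  | succ m ih =>
    rcases Nat.le_succ_iff.mp hij with h | h
    · exact hstep ⟨m, by omega⟩ ⟨m + 1, hm⟩ rfl (ih (by omega) h)
    · exact (Fin.ext h : i = ⟨m + 1, hm⟩) ▸ hi

theorem V12_of_calGEdge {G : SimpleGraph (Fin N)} {V1 : Finset (Fin N)} {u v : Fin N × Fin N}
    (h : calGEdge G V1 u v) (hu : V12 G V1 u) : V12 G V1 v := by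
  have hne := hu.2.2.ne
  simp only [calGEdge, Vdd, V12, V21] at *
  tauto

theorem V21_of_calGEdge {G : SimpleGraph (Fin N)} {V1 : Finset (Fin N)} {u v : Fin N × Fin N}
    (h : calGEdge G V1 u v) (hu : V21 G V1 u) : V21 G V1 v := by
  have hne := hu.2.2.ne
  simp only [calGEdge, Vdd, V12, V21] at *
  tauto

/-- A diagonal prefix followed by vertices of a single class `V₁₂` or `V₂₁` is a path in `𝒢`. -/
theorem isPathCalG_of_threshold {G : SimpleGraph (Fin N)} {V1 : Finset (Fin N)} {n : ℕ}
    {v : Fin n → Fin N × Fin N} (k : ℕ) (hlt : ∀ i : Fin n, i.val < k → Vdd (v i))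
    (hge : (∀ i : Fin n, k ≤ i.val → V12 G V1 (v i)) ∨
      ∀ i : Fin n, k ≤ i.val → V21 G V1 (v i)) :
    IsPathCalG G V1 v := by
  constructor
  · intro i
    rcases lt_or_ge i.val k with hi | hi
    · exact Or.inl (hlt i hi)
    · exact Or.inr (hge.imp (fun h => h i hi) fun h => h i hi)
  · intro i j hij
    rcases lt_or_ge j.val k with hj | hj
    · exact Or.inl ⟨hlt i (by omega), hlt j hj⟩
    · rcases lt_or_ge i.val k with hi | hi
      · exact Or.inr (Or.inr (Or.inr
          ⟨hlt i hi, hge.imp (fun h => h j hj) fun h => h j hj⟩))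
      · rcases hge with h | h
        · exact Or.inr (Or.inl ⟨h i hi, h j hj⟩)
        · exact Or.inr (Or.inr (Or.inl ⟨h i hi, h j hj⟩))

/-- Two distinct words differ at the first letter after their longest common prefix. -/
theorem exists_val_eq_prefixLen {n : ℕ} {x y : Fin n → Fin N} (hxy : x ≠ y) :
    ∃ k : Fin n, k.val = prefixLen x y ∧ x k ≠ y k := by
  obtain ⟨m, hm⟩ := Function.ne_iff.mp hxy
  have hlen : prefixLen x y ≤ m.val :=
    not_lt.mp fun h => hm ((lt_prefixLen_iff x y m).mp h m le_rfl)
  refine ⟨⟨prefixLen x y, hlen.trans_lt m.isLt⟩, rfl, fun heq => ?_⟩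
  refine lt_irrefl (prefixLen x y)
    ((lt_prefixLen_iff x y ⟨prefixLen x y, hlen.trans_lt m.isLt⟩).mpr fun j hj => ?_)
  rcases hj.eq_or_lt with rfl | hj
  · exact heq
  · exact (lt_prefixLen_iff x y j).mp hj j le_rfl

/-- `(x,y) ∈ E(Gₙ)` iff `((x₁,y₁),…,(xₙ,yₙ)) ∈ 𝒫ₙ`. -/
theorem statement1 {N : ℕ} (G : SimpleGraph (Fin N)) (V1 : Finset (Fin N))
    (hV1 : V1.Nonempty) (hV2 : V1ᶜ.Nonempty)
    (hbip : ∀ a b : Fin N, G.Adj a b → (a ∈ V1 ↔ b ∉ V1))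
    {n : ℕ} (hn : 0 < n) (x y : Fin n → Fin N) :
    EdgeRel G V1 x y ↔ IsPathCalG G V1 (fun i => (x i, y i)) := by
  constructor
  · rintro (rfl | ⟨⟨t, hx, hy⟩, hadj⟩)
    · exact ⟨fun _ => Or.inl rfl, fun _ _ _ => Or.inl ⟨rfl, rfl⟩⟩
    · refine isPathCalG_of_threshold (prefixLen x y)
        (fun i hi => (lt_prefixLen_iff x y i).mp hi i le_rfl) ?_
      cases t with
      | true =>
        exact Or.inl fun i hi =>
          ⟨(hx i hi).mpr rfl, fun h => Bool.noConfusion ((hy i hi).mp h), hadj i hi⟩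
      | false =>
        exact Or.inr fun i hi =>
          ⟨fun h => Bool.noConfusion ((hx i hi).mp h), (hy i hi).mpr rfl, hadj i hi⟩
  · rintro ⟨hvert, hedge⟩
    rw [EdgeRel, or_iff_not_imp_left]
    intro hxy
    obtain ⟨k, hk, hne⟩ := exists_val_eq_prefixLen hxy
    rw [← hk]
    rcases hvert k with h | h | h
    · exact absurd h hne
    · have hall := forall_ge_of_step (P := fun i => V12 G V1 (x i, y i))
        (fun i j hij => V12_of_calGEdge (hedge i j hij)) h
      exact ⟨⟨true, fun i hi => iff_of_true (hall i hi).1 rfl,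
        fun i hi => iff_of_false (hall i hi).2.1 Bool.false_ne_true⟩, fun i hi => (hall i hi).2.2⟩
    · have hall := forall_ge_of_step (P := fun i => V21 G V1 (x i, y i))
        (fun i j hij => V21_of_calGEdge (hedge i j hij)) h
      exact ⟨⟨false, fun i hi => iff_of_false (hall i hi).1 Bool.false_ne_true,
        fun i hi => iff_of_true (hall i hi).2.1 rfl⟩, fun i hi => (hall i hi).2.2⟩

end HierGraph
end
end

section
/- Λ = Diag ∪ ⋃_{v ∈ V_dd*} ( f_v(Λ₁₂) ∪ f_v(Λ₂₁) ), where Diag = {(x,x) : x ∈ [0,1]}, V_dd* is the set of all finite words (including the empty word) over V_dd, f_v for a word v = (v₁…v_m) denotes f_{v₁} ∘ ⋯ ∘ f_{v_m} (the identity for the empty word), and Λ₁₂, Λ₂₁ are the attractors of the self-similar iterated function systems {f_v : v ∈ V₁₂} and {f_v : v ∈ V₂₁}, i.e. the unique nonempty compact sets with Λ₁₂ = ⋃_{v∈V₁₂} f_v(Λ₁₂) and Λ₂₁ = ⋃_{v∈V₂₁} f_v(Λ₂₁). -/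
noncomputable section
attribute [local instance] Classical.propDecidable

namespace HierGraph

open Finset MeasureTheory ProbabilityTheory

variable {N : ℕ}

lemma prefixLen_cons_of_ne {n : ℕ} {a b : Fin N} (h : a ≠ b) (x y : Fin n → Fin N) :
    prefixLen (Fin.cons a x : Fin (n + 1) → Fin N) (Fin.cons b y) = 0 := by
  rw [prefixLen, Finset.card_eq_zero, Finset.filter_eq_empty_iff]
  intro i _ hi
  exact h (by simpa using hi 0 (Fin.zero_le i))

lemma prefixLen_cons_self {n : ℕ} (a : Fin N) (x y : Fin n → Fin N) :
    prefixLen (Fin.cons a x : Fin (n + 1) → Fin N) (Fin.cons a y) = prefixLen x y + 1 := by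
  unfold prefixLen
  rw [Fin.card_filter_univ_succ, if_pos]
  · congr 2
    ext i
    simp [Fin.forall_fin_succ]
  · intro j hj
    obtain rfl : j = 0 := Fin.le_zero_iff.mp hj
    simp

lemma edgeRel_cons_self (G : SimpleGraph (Fin N)) (V1 : Finset (Fin N)) {n : ℕ} (a : Fin N)
    (x y : Fin n → Fin N) :
    EdgeRel G V1 (Fin.cons a x : Fin (n + 1) → Fin N) (Fin.cons a y) ↔ EdgeRel G V1 x y := by
  simp [EdgeRel, postfixType, prefixLen_cons_self, Fin.forall_fin_succ]

lemma edgeRel_cons_of_ne (G : SimpleGraph (Fin N)) (V1 : Finset (Fin N)) {n : ℕ} {a b : Fin N}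
    (h : a ≠ b) (x y : Fin n → Fin N) :
    EdgeRel G V1 (Fin.cons a x : Fin (n + 1) → Fin N) (Fin.cons b y) ↔
      (V12 G V1 (a, b) ∧ ∀ i, V12 G V1 (x i, y i)) ∨
        (V21 G V1 (a, b) ∧ ∀ i, V21 G V1 (x i, y i)) := by
  simp only [EdgeRel, postfixType, prefixLen_cons_of_ne h, Fin.forall_fin_succ, V12, V21,
    Fin.cons_zero, Fin.cons_succ, Bool.exists_bool, Fin.cons_inj, h, forall_and]
  simp
  tauto

lemma Ipt_cons {n : ℕ} (a : Fin N) (x : Fin n → Fin N) :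
    Ipt (Fin.cons a x : Fin (n + 1) → Fin N) = (Ipt x + a) / N := by
  simp only [Ipt, Fin.sum_univ_succ, Fin.cons_zero, Fin.cons_succ, Fin.val_succ, Fin.val_zero,
    add_div, Finset.sum_div, pow_succ, pow_zero, one_mul, div_div]
  ring

lemma mem_Iset_cons {n : ℕ} (a : Fin N) (x : Fin n → Fin N) (t : ℝ) :
    (t + a) / N ∈ Iset (Fin.cons a x : Fin (n + 1) → Fin N) ↔ t ∈ Iset x := by
  have hN : (0 : ℝ) < N := by exact_mod_cast a.pos
  have key : (Ipt x + a) / N + 1 / (N : ℝ) ^ (n + 1) = (Ipt x + 1 / (N : ℝ) ^ n + a) / N := by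
    field_simp
    ring
  rw [Iset, Iset, Ipt_cons, key, Set.mem_Icc, Set.mem_Icc, div_le_div_iff_of_pos_right hN,
    div_le_div_iff_of_pos_right hN, add_le_add_iff_right, add_le_add_iff_right]

lemma Qset_cons {n : ℕ} (a b : Fin N) (x y : Fin n → Fin N) :
    Qset (Fin.cons a x : Fin (n + 1) → Fin N) (Fin.cons b y) = fmap N (a, b) '' Qset x y := by
  have hN : (N : ℝ) ≠ 0 := by exact_mod_cast a.pos.ne'
  ext p
  constructor
  · rintro ⟨h1, h2⟩
    have hp : fmap N (a, b) (p.1 * N - a, p.2 * N - b) = p := by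
      ext <;> simp [fmap, hN]
    refine ⟨_, ?_, hp⟩
    rw [← hp] at h1 h2
    exact ⟨(mem_Iset_cons a x _).1 h1, (mem_Iset_cons b y _).1 h2⟩
  · rintro ⟨q, ⟨h1, h2⟩, rfl⟩
    exact ⟨(mem_Iset_cons a x _).2 h1, (mem_Iset_cons b y _).2 h2⟩

lemma Qset_zero (x y : Fin 0 → Fin N) : Qset x y = unitSq := by
  simp [Qset, Iset, Ipt, unitSq]

/-- The `n`-th approximation of the attractor of `{f_v : P v}`, starting from the unit square. -/
def approx (P : Fin N × Fin N → Prop) : ℕ → Set (ℝ × ℝ)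
  | 0 => unitSq
  | n + 1 => ⋃ (v : Fin N × Fin N) (_ : P v), fmap N v '' approx P n

lemma mem_approx (P : Fin N × Fin N → Prop) {n : ℕ} {p : ℝ × ℝ} :
    p ∈ approx P n ↔ ∃ x y : Fin n → Fin N, (∀ i, P (x i, y i)) ∧ p ∈ Qset x y := by
  induction n generalizing p with
  | zero => simp [approx, Qset_zero]
  | succ n ih =>
    simp only [approx, Set.mem_iUnion, Set.mem_image, Fin.exists_fin_succ_pi, Qset_cons,
      Fin.forall_fin_succ, Fin.cons_zero, Fin.cons_succ, ih, Prod.exists, exists_prop]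
    constructor
    · rintro ⟨a, b, hv, s, t, ⟨x, y, hxy, hq⟩, rfl⟩
      exact ⟨a, x, b, y, ⟨hv, hxy⟩, s, t, hq, rfl⟩
    · rintro ⟨a, x, b, y, ⟨hv, hxy⟩, s, t, hq, rfl⟩
      exact ⟨a, b, hv, s, t, ⟨x, y, hxy, hq⟩, rfl⟩

lemma mem_Lam (G : SimpleGraph (Fin N)) (V1 : Finset (Fin N)) {n : ℕ} {p : ℝ × ℝ} :
    p ∈ Lam G V1 n ↔ ∃ x y : Fin n → Fin N, EdgeRel G V1 x y ∧ p ∈ Qset x y := by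
  simp [Lam]

lemma Lam_zero (G : SimpleGraph (Fin N)) (V1 : Finset (Fin N)) : Lam G V1 0 = unitSq := by
  ext p
  simp [mem_Lam, Qset_zero, EdgeRel, Subsingleton.elim _ (Fin.elim0 : Fin 0 → Fin N)]

lemma Lam_succ (G : SimpleGraph (Fin N)) (V1 : Finset (Fin N)) (n : ℕ) :
    Lam G V1 (n + 1) = (⋃ a : Fin N, fmap N (a, a) '' Lam G V1 n) ∪
      (approx (V12 G V1) (n + 1) ∪ approx (V21 G V1) (n + 1)) := by
  ext p
  simp only [Set.mem_union, mem_approx, mem_Lam, Set.mem_iUnion, Set.mem_image,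
    Fin.exists_fin_succ_pi, Fin.forall_fin_succ, Fin.cons_zero, Fin.cons_succ]
  constructor
  · rintro ⟨a, x, b, y, hxy, hp⟩
    by_cases hab : a = b
    · subst hab
      rw [Qset_cons] at hp
      obtain ⟨q, hq, rfl⟩ := hp
      exact .inl ⟨a, q, ⟨x, y, (edgeRel_cons_self G V1 a x y).1 hxy, hq⟩, rfl⟩
    · obtain h | h := (edgeRel_cons_of_ne G V1 hab x y).1 hxy
      · exact .inr (.inl ⟨a, x, b, y, h, hp⟩)
      · exact .inr (.inr ⟨a, x, b, y, h, hp⟩)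
  · rintro (⟨a, q, ⟨x, y, hxy, hq⟩, rfl⟩ | ⟨a, x, b, y, h, hp⟩ | ⟨a, x, b, y, h, hp⟩)
    · exact ⟨a, x, a, y, (edgeRel_cons_self G V1 a x y).2 hxy,
        by rw [Qset_cons]; exact Set.mem_image_of_mem _ hq⟩
    · exact ⟨a, x, b, y, (edgeRel_cons_of_ne G V1 h.1.2.2.ne x y).2 (.inl h), hp⟩
    · exact ⟨a, x, b, y, (edgeRel_cons_of_ne G V1 h.1.2.2.ne x y).2 (.inr h), hp⟩

lemma add_div_mem_Icc (a : Fin N) {t : ℝ} (ht : t ∈ Set.Icc (0 : ℝ) 1) :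
    (t + a) / N ∈ Set.Icc (0 : ℝ) 1 := by
  have hN : (0 : ℝ) < N := by exact_mod_cast a.pos
  have ha : (a : ℝ) + 1 ≤ N := by exact_mod_cast a.isLt
  refine ⟨div_nonneg (add_nonneg ht.1 (Nat.cast_nonneg _)) hN.le, ?_⟩
  rw [div_le_one hN]
  linarith [ht.2]

lemma fmap_mem_unitSq (v : Fin N × Fin N) {p : ℝ × ℝ} (hp : p ∈ unitSq) :
    fmap N v p ∈ unitSq :=
  ⟨add_div_mem_Icc v.1 hp.1, add_div_mem_Icc v.2 hp.2⟩

lemma approx_antitone (P : Fin N × Fin N → Prop) : Antitone (approx P) := by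
  refine antitone_nat_of_succ_le fun n => ?_
  induction n with
  | zero => exact Set.iUnion₂_subset fun v _ => Set.image_subset_iff.2 fun p => fmap_mem_unitSq v
  | succ n ih => exact Set.iUnion₂_mono fun v _ => Set.image_mono ih

lemma Lam_antitone (G : SimpleGraph (Fin N)) (V1 : Finset (Fin N)) : Antitone (Lam G V1) := by
  refine antitone_nat_of_succ_le fun n => ?_
  induction n with
  | zero =>
    rw [Lam_succ, Lam_zero]
    refine Set.union_subset (Set.iUnion_subset fun a => Set.image_subset_iff.2 fun p =>
      fmap_mem_unitSq _) (Set.union_subset ?_ ?_) <;> exact approx_antitone _ (Nat.zero_le 1)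
  | succ n ih =>
    refine (Lam_succ G V1 (n + 1)).trans_subset <|
      Set.Subset.trans ?_ (Lam_succ G V1 n).symm.subset
    exact Set.union_subset_union (Set.iUnion_mono fun a => Set.image_mono ih)
      (Set.union_subset_union (approx_antitone _ (Nat.le_succ _))
        (approx_antitone _ (Nat.le_succ _)))

lemma mem_LamInf (G : SimpleGraph (Fin N)) (V1 : Finset (Fin N)) {p : ℝ × ℝ} :
    p ∈ LamInf G V1 ↔ ∀ n, p ∈ Lam G V1 n := by
  simp only [LamInf, Set.mem_iInter]
  exact ⟨fun h n => Lam_antitone G V1 (Nat.le_succ n) (h (n + 1) (by omega)), fun h n _ => h n⟩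

lemma fmap_mem_LamInf (G : SimpleGraph (Fin N)) (V1 : Finset (Fin N)) (a : Fin N) {p : ℝ × ℝ}
    (hp : p ∈ LamInf G V1) : fmap N (a, a) p ∈ LamInf G V1 := by
  rw [mem_LamInf] at hp ⊢
  refine fun n => Lam_antitone G V1 (Nat.le_succ n) ?_
  rw [Lam_succ]
  exact .inl (Set.mem_iUnion.2 ⟨a, Set.mem_image_of_mem _ (hp n)⟩)

lemma fpath_cons {n : ℕ} (v : Fin (n + 1) → Fin N × Fin N) (p : ℝ × ℝ) :
    fpath v p = fmap N (v 0) (fpath (fun i => v i.succ) p) := by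
  simp [fpath, List.ofFn_succ]

lemma fpath_mem_LamInf (G : SimpleGraph (Fin N)) (V1 : Finset (Fin N)) {n : ℕ}
    {v : Fin n → Fin N × Fin N} (hv : ∀ i, Vdd (v i)) {p : ℝ × ℝ} (hp : p ∈ LamInf G V1) :
    fpath v p ∈ LamInf G V1 := by
  induction n with
  | zero => simpa [fpath] using hp
  | succ n ih =>
    rw [fpath_cons, show v 0 = ((v 0).1, (v 0).1) from Prod.ext rfl (hv 0).symm]
    exact fmap_mem_LamInf G V1 _ (ih fun i => hv _)

lemma exists_add_div_eq (hN : 0 < N) {t : ℝ} (ht : t ∈ Set.Icc (0 : ℝ) 1) :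
    ∃ a : Fin N, ∃ s ∈ Set.Icc (0 : ℝ) 1, (s + a) / N = t := by
  have hN' : (0 : ℝ) < N := by exact_mod_cast hN
  obtain rfl | h1 := ht.2.eq_or_lt
  · refine ⟨⟨N - 1, by omega⟩, 1, by simp, ?_⟩
    rw [div_eq_one_iff_eq hN'.ne', Nat.cast_sub hN]
    simp
  · have h0 : 0 ≤ t * N := mul_nonneg ht.1 hN'.le
    have hlt : t * N < N := by nlinarith
    refine ⟨⟨⌊t * N⌋₊, (Nat.floor_lt h0).2 hlt⟩, t * N - ⌊t * N⌋₊,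
      ⟨sub_nonneg.2 (Nat.floor_le h0), ?_⟩, ?_⟩
    · linarith [Nat.lt_floor_add_one (t * N)]
    · simp [hN'.ne']

lemma DiagSet_subset_LamInf (hN : 0 < N) (G : SimpleGraph (Fin N)) (V1 : Finset (Fin N)) :
    DiagSet ⊆ LamInf G V1 := by
  rintro _ ⟨t, ht, rfl⟩
  rw [mem_LamInf]
  intro n
  induction n generalizing t with
  | zero => rw [Lam_zero]; exact ⟨ht, ht⟩
  | succ n ih =>
    obtain ⟨a, s, hs, rfl⟩ := exists_add_div_eq hN ht
    rw [Lam_succ]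
    exact .inl (Set.mem_iUnion.2 ⟨a, (s, s), ih s hs, rfl⟩)

section Attractor

variable {P : Fin N × Fin N → Prop} {L : Set (ℝ × ℝ)}

lemma mem_Icc_of_selfSimilar (hN : 1 < N) (hne : L.Nonempty) (hc : IsCompact L)
    {g : ℝ × ℝ → ℝ} (hg : Continuous g)
    (hL : ∀ p ∈ L, ∃ q ∈ L, ∃ a : Fin N, g p = (g q + a) / N) {p : ℝ × ℝ} (hp : p ∈ L) :
    g p ∈ Set.Icc (0 : ℝ) 1 := by
  have hN' : (1 : ℝ) < N := by exact_mod_cast hN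
  obtain ⟨r, hr, hmin⟩ := hc.exists_isMinOn hne hg.continuousOn
  obtain ⟨s, hs, hmax⟩ := hc.exists_isMaxOn hne hg.continuousOn
  constructor
  · obtain ⟨q, hq, a, h⟩ := hL r hr
    rw [eq_div_iff (by positivity)] at h
    have h1 : g r ≤ g q := hmin hq
    have h2 : (0 : ℝ) ≤ a := Nat.cast_nonneg _
    have h3 : g r ≤ g p := hmin hp
    nlinarith
  · obtain ⟨q, hq, a, h⟩ := hL s hs
    rw [eq_div_iff (by positivity)] at h
    have h1 : g q ≤ g s := hmax hq
    have h2 : (a : ℝ) + 1 ≤ N := by exact_mod_cast a.isLt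
    have h3 : g p ≤ g s := hmax hp
    nlinarith

lemma subset_unitSq_of_selfSimilar (hN : 1 < N) (hne : L.Nonempty) (hc : IsCompact L)
    (hL : L = ⋃ (v : Fin N × Fin N) (_ : P v), fmap N v '' L) : L ⊆ unitSq := by
  have key : ∀ p ∈ L, ∃ q ∈ L, ∃ v : Fin N × Fin N, fmap N v q = p := by
    intro p hp
    rw [hL] at hp
    simp only [Set.mem_iUnion] at hp
    obtain ⟨v, _, q, hq, rfl⟩ := hp
    exact ⟨q, hq, v, rfl⟩
  intro p hp
  constructor
  · refine mem_Icc_of_selfSimilar hN hne hc continuous_fst (fun p hp => ?_) hp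
    obtain ⟨q, hq, v, rfl⟩ := key p hp
    exact ⟨q, hq, v.1, rfl⟩
  · refine mem_Icc_of_selfSimilar hN hne hc continuous_snd (fun p hp => ?_) hp
    obtain ⟨q, hq, v, rfl⟩ := key p hp
    exact ⟨q, hq, v.2, rfl⟩

lemma subset_approx_of_selfSimilar (hN : 1 < N) (hne : L.Nonempty) (hc : IsCompact L)
    (hL : L = ⋃ (v : Fin N × Fin N) (_ : P v), fmap N v '' L) (n : ℕ) : L ⊆ approx P n := by
  induction n with
  | zero => exact subset_unitSq_of_selfSimilar hN hne hc hL
  | succ n ih =>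
    rw [hL]
    exact Set.iUnion₂_mono fun v _ => Set.image_mono ih

lemma dist_fmap (v : Fin N × Fin N) (p q : ℝ × ℝ) :
    dist (fmap N v p) (fmap N v q) = dist p q / N := by
  simp only [fmap, Prod.dist_eq, Real.dist_eq, ← sub_div, add_sub_add_right_eq_sub, abs_div,
    Nat.abs_cast, max_div_div_right (Nat.cast_nonneg N : (0 : ℝ) ≤ N)]

lemma exists_dist_le_of_mem_approx (hN : 1 < N) (hne : L.Nonempty) (hc : IsCompact L)
    (hL : L = ⋃ (v : Fin N × Fin N) (_ : P v), fmap N v '' L) {n : ℕ} {p : ℝ × ℝ}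
    (hp : p ∈ approx P n) : ∃ q ∈ L, dist p q ≤ (1 / (N : ℝ)) ^ n := by
  induction n generalizing p with
  | zero =>
    obtain ⟨q, hq⟩ := hne
    have hq' := subset_unitSq_of_selfSimilar hN ⟨q, hq⟩ hc hL hq
    refine ⟨q, hq, ?_⟩
    rw [pow_zero, Prod.dist_eq]
    refine max_le ?_ ?_
    · simpa using Real.dist_le_of_mem_Icc hp.1 hq'.1
    · simpa using Real.dist_le_of_mem_Icc hp.2 hq'.2
  | succ n ih =>
    simp only [approx, Set.mem_iUnion] at hp
    obtain ⟨v, hv, r, hr, rfl⟩ := hp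
    obtain ⟨q, hq, hrq⟩ := ih hr
    refine ⟨fmap N v q, ?_, ?_⟩
    · rw [hL]
      exact Set.mem_iUnion₂.2 ⟨v, hv, Set.mem_image_of_mem _ hq⟩
    · rw [dist_fmap, pow_succ, mul_one_div]
      gcongr

lemma iInter_approx_eq_of_selfSimilar (hN : 1 < N) (hne : L.Nonempty) (hc : IsCompact L)
    (hL : L = ⋃ (v : Fin N × Fin N) (_ : P v), fmap N v '' L) : ⋂ n, approx P n = L := by
  refine Set.Subset.antisymm (fun p hp => ?_)
    (Set.subset_iInter (subset_approx_of_selfSimilar hN hne hc hL))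
  rw [← hc.isClosed.closure_eq, Metric.mem_closure_iff]
  intro ε hε
  have hN' : (1 : ℝ) / N < 1 := by
    rw [div_lt_one (by positivity)]
    exact_mod_cast hN
  obtain ⟨n, hn⟩ := exists_pow_lt_of_lt_one hε hN'
  obtain ⟨q, hq, hpq⟩ := exists_dist_le_of_mem_approx hN hne hc hL (Set.mem_iInter.1 hp n)
  exact ⟨q, hq, hpq.trans_lt hn⟩

end Attractor

lemma exists_forall_of_antitone {ι : Type*} [Finite ι] {A : ι → ℕ → Prop}
    (hA : ∀ i, Antitone (A i)) (h : ∀ n, ∃ i, A i n) : ∃ i, ∀ n, A i n := by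
  by_contra! hcon
  choose k hk using hcon
  obtain ⟨K, hK⟩ := (Set.finite_range k).bddAbove
  obtain ⟨i, hi⟩ := h K
  exact hk i (hA i (hK ⟨i, rfl⟩) hi)

lemma fmap_injective (v : Fin N × Fin N) : Function.Injective (fmap N v) := by
  have hN : (N : ℝ) ≠ 0 := by exact_mod_cast v.1.pos.ne'
  intro p q h
  simp only [fmap, Prod.mk.injEq, div_left_inj' hN, add_left_inj] at h
  exact Prod.ext h.1 h.2

lemma LamInf_cases (G : SimpleGraph (Fin N)) (V1 : Finset (Fin N)) {p : ℝ × ℝ}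
    (hp : p ∈ LamInf G V1) :
    p ∈ ⋂ n, approx (V12 G V1) n ∨ p ∈ ⋂ n, approx (V21 G V1) n ∨
      ∃ a : Fin N, ∃ q ∈ LamInf G V1, fmap N (a, a) q = p := by
  by_contra! hcon
  obtain ⟨h1, h2, h3⟩ := hcon
  simp only [Set.mem_iInter, not_forall] at h1 h2
  obtain ⟨k, hk⟩ := h1
  obtain ⟨l, hl⟩ := h2
  rw [mem_LamInf] at hp
  obtain ⟨a, ha⟩ := exists_forall_of_antitone (A := fun a n => p ∈ fmap N (a, a) '' Lam G V1 n)
    (fun a m n hmn => Set.image_mono (Lam_antitone G V1 hmn) (a := p)) fun n => by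
      have h := hp (n + k + l + 1)
      rw [Lam_succ] at h
      obtain h | h | h := h
      · obtain ⟨a, ha⟩ := Set.mem_iUnion.1 h
        exact ⟨a, Set.image_mono (Lam_antitone G V1 (by omega)) ha⟩
      · exact absurd (approx_antitone _ (by omega) h) hk
      · exact absurd (approx_antitone _ (by omega) h) hl
  obtain ⟨q, -, rfl⟩ := ha 0
  refine h3 a q ((mem_LamInf G V1).2 fun n => ?_) rfl
  exact (fmap_injective _).mem_set_image.1 (ha n)

lemma exists_fpath_of_mem_LamInf (G : SimpleGraph (Fin N)) (V1 : Finset (Fin N)) (K : ℕ)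
    {p : ℝ × ℝ} (hp : p ∈ LamInf G V1) (hK : 1 < (N : ℝ) ^ K * |p.1 - p.2|) :
    ∃ (m : ℕ) (v : Fin m → Fin N × Fin N), (∀ i, Vdd (v i)) ∧
      ∃ q ∈ (⋂ n, approx (V12 G V1) n) ∪ ⋂ n, approx (V21 G V1) n, fpath v q = p := by
  induction K generalizing p with
  | zero =>
    have h0 := (mem_LamInf G V1).1 hp 0
    rw [Lam_zero] at h0
    have := Real.dist_le_of_mem_Icc h0.1 h0.2
    rw [Real.dist_eq] at this
    linarith
  | succ K ih =>
    obtain h | h | ⟨a, q, hq, rfl⟩ := LamInf_cases G V1 hp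
    · exact ⟨0, Fin.elim0, fun i => i.elim0, p, .inl h, by simp [fpath]⟩
    · exact ⟨0, Fin.elim0, fun i => i.elim0, p, .inr h, by simp [fpath]⟩
    · have hN : (0 : ℝ) < N := by exact_mod_cast a.pos
      obtain ⟨m, v, hv, r, hr, rfl⟩ := ih hq <| by
        rw [fmap, ← sub_div, add_sub_add_right_eq_sub, abs_div, Nat.abs_cast] at hK
        calc 1 < _ := hK
          _ = _ := by field_simp; ring
      refine ⟨m + 1, Fin.cons (a, a) v, ?_, r, hr, by simp [fpath_cons]⟩
      exact Fin.forall_fin_succ.2 ⟨by simp [Vdd], by simpa using hv⟩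

/-- `Λ = Diag ∪ ⋃_{v ∈ V_dd*} (f_v(Λ₁₂) ∪ f_v(Λ₂₁))`. -/
theorem statement3 {N : ℕ} (G : SimpleGraph (Fin N)) (V1 : Finset (Fin N))
    (hV1 : V1.Nonempty) (hV2 : V1ᶜ.Nonempty)
    (hbip : ∀ a b : Fin N, G.Adj a b → (a ∈ V1 ↔ b ∉ V1))
    (L12 L21 : Set (ℝ × ℝ))
    (h12ne : L12.Nonempty) (h12c : IsCompact L12)
    (h21ne : L21.Nonempty) (h21c : IsCompact L21)
    (h12 : L12 = ⋃ (v : Fin N × Fin N) (_ : V12 G V1 v), fmap N v '' L12)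
    (h21 : L21 = ⋃ (v : Fin N × Fin N) (_ : V21 G V1 v), fmap N v '' L21) :
    LamInf G V1 = DiagSet ∪
      ⋃ (m : ℕ) (v : Fin m → Fin N × Fin N) (_ : ∀ i, Vdd (v i)),
        (fpath v '' L12 ∪ fpath v '' L21) := by
  have hN : 1 < N := by
    obtain ⟨a, ha⟩ := hV1
    obtain ⟨b, hb⟩ := hV2
    have hab : a ≠ b := by
      rintro rfl
      exact (Finset.mem_compl.1 hb) ha
    have := Fin.val_ne_of_ne hab
    omega
  have e12 := iInter_approx_eq_of_selfSimilar hN h12ne h12c h12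
  have e21 := iInter_approx_eq_of_selfSimilar hN h21ne h21c h21
  apply Set.Subset.antisymm
  · intro p hp
    by_cases hd : p.1 = p.2
    · have h0 := (mem_LamInf G V1).1 hp 0
      rw [Lam_zero] at h0
      exact .inl ⟨p.1, h0.1, Prod.ext rfl hd⟩
    · have hpos : 0 < |p.1 - p.2| := abs_pos.2 (sub_ne_zero.2 hd)
      obtain ⟨K, hK⟩ := pow_unbounded_of_one_lt (1 / |p.1 - p.2|)
        (show (1 : ℝ) < N by exact_mod_cast hN)
      obtain ⟨m, v, hv, q, hq, rfl⟩ :=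
        exists_fpath_of_mem_LamInf G V1 K hp ((div_lt_iff₀ hpos).1 hK)
      rw [e12, e21] at hq
      refine .inr (Set.mem_iUnion.2 ⟨m, Set.mem_iUnion₂.2 ⟨v, hv, ?_⟩⟩)
      rw [← Set.image_union]
      exact Set.mem_image_of_mem _ hq
  · refine Set.union_subset (DiagSet_subset_LamInf (by omega) G V1)
      (Set.iUnion_subset fun m => Set.iUnion₂_subset fun v hv => ?_)
    rw [← Set.image_union, Set.image_subset_iff]
    intro q hq
    refine fpath_mem_LamInf G V1 hv ((mem_LamInf G V1).2 fun n => Lam_antitone G V1 n.le_succ ?_)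
    rw [Lam_succ]
    obtain hq | hq := hq
    · exact .inr (.inl (subset_approx_of_selfSimilar hN h12ne h12c h12 _ hq))
    · exact .inr (.inr (subset_approx_of_selfSimilar hN h21ne h21c h21 _ hq))


end HierGraph
end
end

section
/- If |V₁| = n₁ = 1, then assumption (A1) holds with d₁ = |E(G)|, and the power-law tail exponent of the degree distribution of G_n satisfies γ̃ = log N / log|E(G)| = 1 / dim_H(Λ \ Diag), where γ̃ = log(N/n₁)/log d₁ and Diag = {(x,x) : x ∈ [0,1]}. -/
noncomputable section
attribute [local instance] Classical.propDecidable

namespace HierGraph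

open Finset MeasureTheory ProbabilityTheory

variable {N : ℕ}

/-- A reparametrization version of `HolderOnWith.dimH_image_le`. -/
theorem dimH_range_le_of_dist_le_rpow {α X Y : Type*} [MetricSpace X] [MetricSpace Y]
    {f : α → X} {g : α → Y} {K r : NNReal} (hr : 0 < r)
    (h : ∀ a b, dist (g a) (g b) ≤ K * dist (f a) (f b) ^ (r : ℝ)) :
    dimH (Set.range g) ≤ dimH (Set.range f) / r := by
  rcases isEmpty_or_nonempty α with hα | hα
  · simp [Set.range_eq_empty]
  have hg : Set.range g = (g ∘ Function.invFun f) '' Set.range f := by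
    have key (a : α) : g (Function.invFun f (f a)) = g a := by
      have := h (Function.invFun f (f a)) a
      rw [Function.invFun_eq (f := f) ⟨a, rfl⟩, dist_self,
        Real.zero_rpow (NNReal.coe_pos.2 hr).ne', mul_zero] at this
      exact dist_le_zero.1 this
    rw [← Set.range_comp]
    exact congrArg Set.range (funext fun a => (key a).symm)
  rw [hg]
  refine HolderOnWith.dimH_image_le (C := K) (fun x hx y hy => ?_) hr
  have := h (Function.invFun f x) (Function.invFun f y)
  rw [Function.invFun_eq hx, Function.invFun_eq hy] at this
  rw [edist_dist, edist_dist, ENNReal.ofReal_rpow_of_nonneg dist_nonneg r.coe_nonneg,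
    ← ENNReal.ofReal_coe_nnreal, ← ENNReal.ofReal_mul K.coe_nonneg]
  exact ENNReal.ofReal_le_ofReal this

/-- The integer with base-`b` digits `a 0, …, a (n - 1)`, most significant digit first. -/
def digitInt {b : ℕ} (a : ℕ → Fin b) : ℕ → ℤ
  | 0 => 0
  | n + 1 => b * digitInt a n + (a n : ℕ)

theorem digitInt_cast {b : ℕ} (a : ℕ → Fin b) (n : ℕ) :
    (digitInt a n : ℝ) = b ^ n * ∑ i ∈ range n, Real.ofDigitsTerm a i := by
  have hb : (b : ℝ) ≠ 0 := Nat.cast_ne_zero.2 (Fin.pos (a 0)).ne'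
  induction n with
  | zero => simp [digitInt]
  | succ n ih =>
    rw [sum_range_succ, digitInt, Real.ofDigitsTerm]
    push_cast
    rw [ih]
    field_simp
    ring

theorem pow_mul_ofDigits_mem_Icc {b : ℕ} (a : ℕ → Fin b) (n : ℕ) :
    (b : ℝ) ^ n * Real.ofDigits a ∈ Set.Icc (digitInt a n : ℝ) (digitInt a n + 1) := by
  have hb : (b : ℝ) ^ n ≠ 0 := pow_ne_zero _ (Nat.cast_ne_zero.2 (Fin.pos (a 0)).ne')
  rw [digitInt_cast, Real.ofDigits_eq_sum_add_ofDigits a n, mul_add, mul_inv_cancel_left₀ hb]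
  have h0 := Real.ofDigits_nonneg fun i => a (i + n)
  have h1 := Real.ofDigits_le_one fun i => a (i + n)
  constructor <;> linarith

theorem sub_le_sub_of_strictMono_fin {d N : ℕ} {e : Fin d → Fin N} (he : StrictMono e)
    {i j : Fin d} (hij : i ≤ j) : (j : ℤ) - i ≤ (e j : ℤ) - e i := by
  obtain ⟨i, hi⟩ := i
  obtain ⟨j, hj⟩ := j
  obtain ⟨k, rfl⟩ := Nat.exists_eq_add_of_le (Fin.mk_le_mk.1 hij)
  induction k with
  | zero => simp
  | succ k ih =>
    have h1 := ih (by omega) (Fin.mk_le_mk.2 (by omega))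
    have h2 : e ⟨i + k, by omega⟩ < e ⟨i + (k + 1), hj⟩ := he (Fin.mk_lt_mk.2 (by omega))
    rw [Fin.lt_def] at h2
    push_cast at h1 ⊢
    omega

theorem digitInt_sub_le {d N : ℕ} {e : Fin d → Fin N} (he : StrictMono e)
    (a b : ℕ → Fin d) (n : ℕ) (h : digitInt a n ≤ digitInt b n) :
    digitInt b n - digitInt a n ≤ digitInt (e ∘ b) n - digitInt (e ∘ a) n := by
  induction n with
  | zero => simp [digitInt]
  | succ n ih =>
    have hd : 0 < d := Fin.pos (a 0)
    have ha0 := sub_le_sub_of_strictMono_fin he (Fin.mk_le_of_le_val (Nat.zero_le (a n)) :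
      (⟨0, hd⟩ : Fin d) ≤ a n)
    have hb0 := sub_le_sub_of_strictMono_fin he (Fin.mk_le_of_le_val (Nat.zero_le (b n)) :
      (⟨0, hd⟩ : Fin d) ≤ b n)
    have ha1 := sub_le_sub_of_strictMono_fin he (i := a n) (j := ⟨d - 1, by omega⟩)
      (Fin.le_def.2 (by simp; omega))
    have hb1 := sub_le_sub_of_strictMono_fin he (i := b n) (j := ⟨d - 1, by omega⟩)
      (Fin.le_def.2 (by simp; omega))
    have := (e ⟨d - 1, by omega⟩).isLt
    have := (a n).isLt
    have := (b n).isLt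
    simp only [digitInt, Function.comp_apply] at h ⊢ ih
    simp only at ha0 hb0 ha1 hb1
    set A := digitInt a n
    set B := digitInt b n
    set A' := digitInt (e ∘ a) n
    set B' := digitInt (e ∘ b) n
    have hAB : A ≤ B := by
      by_contra! hlt
      nlinarith
    rcases hAB.eq_or_lt with heq | hlt
    · have h1 := ih hAB
      have h2 := sub_le_sub_of_strictMono_fin he (i := a n) (j := b n) (Fin.le_def.2 (by
        rw [heq] at h; omega))
      rw [heq] at h1 ⊢
      nlinarith
    · have h1 := ih hAB
      have hNd : (d : ℤ) ≤ N := by omega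
      have h2 : (d : ℤ) * (B - A) + (N - d) ≤ N * (B' - A') := by nlinarith
      push_cast [Nat.cast_pred hd] at ha0 ha1 hb0 hb1
      linarith

theorem inv_pow_le_ofDigits_sub {d N : ℕ} {e : Fin d → Fin N} (he : StrictMono e)
    (a b : ℕ → Fin d) (n : ℕ)
    (h : 3 * ((d : ℝ) ^ n)⁻¹ ≤ Real.ofDigits b - Real.ofDigits a) :
    ((N : ℝ) ^ n)⁻¹ ≤ Real.ofDigits (e ∘ b) - Real.ofDigits (e ∘ a) := by
  have hd : (0 : ℝ) < d ^ n := pow_pos (Nat.cast_pos.2 (Fin.pos (a 0))) _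
  have hN : (0 : ℝ) < N ^ n := pow_pos (Nat.cast_pos.2 (Fin.pos (e (a 0)))) _
  obtain ⟨ha0, ha1⟩ := pow_mul_ofDigits_mem_Icc a n
  obtain ⟨hb0, hb1⟩ := pow_mul_ofDigits_mem_Icc b n
  obtain ⟨hea0, hea1⟩ := pow_mul_ofDigits_mem_Icc (e ∘ a) n
  obtain ⟨heb0, heb1⟩ := pow_mul_ofDigits_mem_Icc (e ∘ b) n
  rw [← div_eq_mul_inv, div_le_iff₀ hd] at h
  rw [← one_div, div_le_iff₀ hN]
  have h2 : (2 : ℝ) ≤ ((digitInt b n - digitInt a n : ℤ) : ℝ) := by push_cast; linarith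
  have h2' : (2 : ℤ) ≤ digitInt b n - digitInt a n := by exact_mod_cast h2
  have h3 : (2 : ℤ) ≤ digitInt (e ∘ b) n - digitInt (e ∘ a) n :=
    h2'.trans (digitInt_sub_le he a b n (by omega))
  have h4 : (2 : ℝ) ≤ digitInt (e ∘ b) n - digitInt (e ∘ a) n := by exact_mod_cast h3
  linarith

theorem inv_pow_rpow_log_div_log {d N : ℕ} (hd : 0 < d) (hN : 1 < N) (n : ℕ) :
    ((N : ℝ) ^ n)⁻¹ ^ (Real.log d / Real.log N) = ((d : ℝ) ^ n)⁻¹ := by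
  have hN' : (0 : ℝ) < N := by positivity
  have hd' : (0 : ℝ) < d := by positivity
  have hlog : Real.log N ≠ 0 := (Real.log_pos (by exact_mod_cast hN)).ne'
  rw [Real.inv_rpow (by positivity), ← Real.rpow_natCast, ← Real.rpow_mul hN'.le, mul_comm,
    Real.rpow_mul hN'.le, Real.rpow_natCast, Real.rpow_def_of_pos hN', mul_div_cancel₀ _ hlog,
    Real.exp_log hd']

theorem dist_ofDigits_le {d N : ℕ} (hd : 1 < d) {e : Fin d → Fin N} (he : StrictMono e)
    (a b : ℕ → Fin d) :
    dist (Real.ofDigits a) (Real.ofDigits b) ≤ 3 * d *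
      dist (Real.ofDigits (e ∘ a)) (Real.ofDigits (e ∘ b)) ^ (Real.log d / Real.log N) := by
  have hN : 1 < N := hd.trans_le (by simpa using Fintype.card_le_of_injective e he.injective)
  wlog hab : Real.ofDigits a ≤ Real.ofDigits b generalizing a b
  · rw [dist_comm, dist_comm (Real.ofDigits (e ∘ a))]
    exact this b a (le_of_not_ge hab)
  rcases hab.eq_or_lt with heq | hlt
  · rw [heq, dist_self]
    positivity
  have hd0 : (0 : ℝ) < d := by positivity
  have hd1 : (1 : ℝ) < d := by exact_mod_cast hd
  have ha := Real.ofDigits_nonneg a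
  have hb := Real.ofDigits_le_one b
  obtain ⟨n, hn1, hn2⟩ := exists_nat_pow_near_of_lt_one
    (x := (Real.ofDigits b - Real.ofDigits a) / 3) (y := (d : ℝ)⁻¹) (by linarith) (by linarith)
    (by positivity) (inv_lt_one_of_one_lt₀ hd1)
  rw [inv_pow] at hn1 hn2
  have h1 := inv_pow_le_ofDigits_sub he a b (n + 1) (by linarith)
  have h2 := Real.rpow_le_rpow (by positivity) h1 (z := Real.log d / Real.log N) (by positivity)
  rw [inv_pow_rpow_log_div_log (by omega) hN] at h2
  rw [dist_comm, Real.dist_eq, abs_of_pos (by linarith), dist_comm, Real.dist_eq,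
    abs_of_pos ((by positivity : (0 : ℝ) < ((N : ℝ) ^ (n + 1))⁻¹).trans_le h1)]
  calc Real.ofDigits b - Real.ofDigits a ≤ 3 * ((d : ℝ) ^ n)⁻¹ := by linarith
    _ = 3 * d * ((d : ℝ) ^ (n + 1))⁻¹ := by field_simp; ring
    _ ≤ _ := by gcongr

/-- The Hausdorff dimension of the set of reals all of whose base-`N` digits lie in a given set
of `d` digits is at least `log d / log N`. -/
theorem log_div_log_le_dimH_range_ofDigits {d N : ℕ} (hd : 1 < d) {e : Fin d → Fin N}
    (he : StrictMono e) :
    ENNReal.ofReal (Real.log d / Real.log N) ≤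
      dimH (Set.range fun a : ℕ → Fin d => Real.ofDigits (e ∘ a)) := by
  have hN : 1 < N := hd.trans_le (by simpa using Fintype.card_le_of_injective e he.injective)
  have hr : 0 < Real.log d / Real.log N :=
    div_pos (Real.log_pos (by exact_mod_cast hd)) (Real.log_pos (by exact_mod_cast hN))
  have h := dimH_range_le_of_dist_le_rpow (K := 3 * d) (r := (Real.log d / Real.log N).toNNReal)
    (f := fun a : ℕ → Fin d => Real.ofDigits (e ∘ a)) (g := Real.ofDigits)
    (Real.toNNReal_pos.2 hr) (fun a b => by
      rw [Real.coe_toNNReal _ hr.le]; exact_mod_cast dist_ofDigits_le hd he a b)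
  have h1 : 1 ≤ dimH (Set.range (Real.ofDigits (b := d))) := by
    rw [← Set.image_univ]
    refine le_trans ?_ (dimH_mono (Real.ofDigits_SurjOn hd))
    rw [Real.dimH_of_nonempty_interior (by simp)]
    simp
  have h2 := h1.trans h
  rwa [ENNReal.le_div_iff_mul_le (by simpa using Or.inl hr) (by simp), one_mul] at h2

theorem card_edgeFinset_eq_degH (G : SimpleGraph (Fin N)) [Fintype G.edgeSet] (c : Fin N)
    (hc : ∀ a b, G.Adj a b → a = c ∨ b = c) : G.edgeFinset.card = degH G c := by
  have : G.edgeFinset = (univ.filter fun w => G.Adj c w).image fun w => s(c, w) := by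
    ext e
    induction e with
    | h a b =>
      simp only [SimpleGraph.mem_edgeFinset, SimpleGraph.mem_edgeSet, mem_image, mem_filter,
        mem_univ, true_and]
      constructor
      · intro h
        rcases hc a b h with rfl | rfl
        · exact ⟨b, h, rfl⟩
        · exact ⟨a, h.symm, Sym2.eq_swap⟩
      · rintro ⟨w, hw, h⟩
        rwa [← SimpleGraph.mem_edgeSet, ← h]
  rw [this, card_image_of_injective _ fun a b h => Sym2.congr_right.1 h, degH]

theorem ofDigits_mem_Iset (a : ℕ → Fin N) (n : ℕ) :
    Real.ofDigits a ∈ Iset fun i : Fin n => a i := by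
  have hN : (0 : ℝ) < N ^ n := pow_pos (Nat.cast_pos.2 (Fin.pos (a 0))) _
  have hI : Ipt (fun i : Fin n => a i) = ∑ i ∈ range n, Real.ofDigitsTerm a i := by
    rw [Ipt, ← Fin.sum_univ_eq_sum_range]
    rfl
  rw [Iset, hI, Real.ofDigits_eq_sum_add_ofDigits a n, one_div]
  have h0 := Real.ofDigits_nonneg fun i => a (i + n)
  have h1 := Real.ofDigits_le_one fun i => a (i + n)
  constructor
  · have := mul_nonneg (inv_nonneg.2 hN.le) h0
    linarith
  · have := mul_le_of_le_one_right (inv_nonneg.2 hN.le) h1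
    linarith

theorem exists_ofDigits_mem_Iset (c : Fin N) {n : ℕ} (x : Fin n → Fin N) :
    ∃ a : ℕ → Fin N, (∀ i : Fin n, a i = x i) ∧ Real.ofDigits a ∈ Iset x := by
  refine ⟨fun i => if h : i < n then x ⟨i, h⟩ else c, fun i => by simp, ?_⟩
  convert ofDigits_mem_Iset (fun i => if h : i < n then x ⟨i, h⟩ else c) n using 2
  simp

theorem mem_LamInf_of_adj (G : SimpleGraph (Fin N)) (c : Fin N) (a : ℕ → Fin N)
    (ha : ∀ i, G.Adj c (a i)) :
    (Real.ofDigits fun _ => c, Real.ofDigits a) ∈ LamInf G {c} := by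
  refine Set.mem_iInter₂.2 fun n _ => Set.mem_iUnion₂.2
    ⟨(fun _ => c, fun i => a i), Or.inr ⟨⟨true, ?_, ?_⟩, fun i _ => ha i⟩,
      ofDigits_mem_Iset (fun _ => c) n, ofDigits_mem_Iset a n⟩
  · simp [postfixType]
  · intro i _
    simpa using (ha i).ne'

theorem prefixLen_le_of_ne {n : ℕ} {x y : Fin n → Fin N} {i : Fin n} (h : x i ≠ y i) :
    prefixLen x y ≤ i := by
  rw [← Fin.card_Iio]
  refine card_le_card fun j hj => ?_
  rw [mem_Iio]
  by_contra! hij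
  exact h ((mem_filter.1 hj).2 i hij)

theorem abs_sub_le_of_mem_Qset {n k : ℕ} (hk : k ≤ n) {x y : Fin n → Fin N}
    (h : ∀ i : Fin n, i.val < k → x i = y i) {p : ℝ × ℝ} (hp : p ∈ Qset x y) (c : Fin N) :
    |p.1 - p.2| ≤ 3 * ((N : ℝ) ^ k)⁻¹ := by
  obtain ⟨a, hax, ha⟩ := exists_ofDigits_mem_Iset c x
  obtain ⟨b, hby, hb⟩ := exists_ofDigits_mem_Iset c y
  have hab := abs_le.1 (Real.abs_ofDigits_sub_ofDigits_le (x := a) (y := b) (n := k)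
    fun i hi => by
      rw [hax ⟨i, by omega⟩, hby ⟨i, by omega⟩, h _ hi])
  have hN : (1 : ℝ) ≤ N := by exact_mod_cast Fin.pos c
  have hnk : ((N : ℝ) ^ n)⁻¹ ≤ ((N : ℝ) ^ k)⁻¹ := by gcongr
  obtain ⟨⟨h1, h2⟩, ⟨h3, h4⟩⟩ := hp
  obtain ⟨h5, h6⟩ := ha
  obtain ⟨h7, h8⟩ := hb
  rw [one_div] at h2 h4 h6 h8
  rw [abs_le]
  constructor <;> linarith

theorem ediam_Qset_le {n : ℕ} (x y : Fin n → Fin N) :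
    Metric.ediam (Qset x y) ≤ ENNReal.ofReal ((N : ℝ) ^ n)⁻¹ := by
  refine Metric.ediam_le fun p hp q hq => ?_
  rw [Prod.edist_eq]
  obtain ⟨⟨h1, h2⟩, ⟨h3, h4⟩⟩ := hp
  obtain ⟨⟨h5, h6⟩, ⟨h7, h8⟩⟩ := hq
  rw [one_div] at h2 h4 h6 h8
  refine max_le ?_ ?_ <;> rw [edist_dist, Real.dist_eq] <;>
    refine ENNReal.ofReal_le_ofReal (abs_le.2 ⟨?_, ?_⟩) <;> linarith

/-- The word whose first `k` letters are given by `u` and the remaining ones by `x`. -/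
def prependWord {n k : ℕ} (u : Fin k → Fin N) (x : Fin n → Fin N) : Fin n → Fin N :=
  fun i => if h : i.val < k then u ⟨i, h⟩ else x i

/-- The squares covering the part of `Λ` away from the diagonal when `V₁ = {c}` and the range
of `e` is the set of neighbors of `c`. -/
def starSquare (c : Fin N) {d : ℕ} (e : Fin d → Fin N) (k n : ℕ)
    (q : Bool × (Fin k → Fin N) × (Fin k → Fin N) × (Fin n → Fin d)) : Set (ℝ × ℝ) :=
  if q.1 then Qset (prependWord q.2.1 fun _ => c) (prependWord q.2.2.1 (e ∘ q.2.2.2))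
  else Qset (prependWord q.2.1 (e ∘ q.2.2.2)) (prependWord q.2.2.1 fun _ => c)

theorem mem_iUnion_starSquare (G : SimpleGraph (Fin N)) (c : Fin N) {d : ℕ} (hd : 0 < d)
    (e : Fin d → Fin N) (he : ∀ b, G.Adj c b → b ∈ Set.range e) {k n : ℕ} (hk : k ≤ n)
    {p : ℝ × ℝ} (hp : p ∈ Lam G {c} n) (hpk : 3 * ((N : ℝ) ^ k)⁻¹ < |p.1 - p.2|) :
    p ∈ ⋃ q, starSquare c e k n q := by
  obtain ⟨⟨x, y⟩, hxy, hpQ⟩ := Set.mem_iUnion₂.1 hp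
  dsimp only at hxy hpQ
  obtain ⟨i₀, hi₀, hne⟩ : ∃ i : Fin n, i.val < k ∧ x i ≠ y i := by
    by_contra! h
    exact (abs_sub_le_of_mem_Qset hk h hpQ c).not_gt hpk
  rcases hxy with rfl | ⟨⟨t, htx, hty⟩, hadj⟩
  · exact absurd rfl hne
  have hpre : ∀ i : Fin n, ¬ i.val < k → prefixLen x y ≤ i.val := fun i hi => by
    have := prefixLen_le_of_ne hne
    omega
  have hconst : ∀ z : Fin n → Fin N, (∀ i : Fin n, ¬ i.val < k → z i = c) →
      z = prependWord (fun i : Fin k => z (i.castLE hk)) fun _ => c := fun z hz => by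
    funext i
    by_cases hi : i.val < k
    · simp [prependWord, hi]
    · simp [prependWord, hi, hz i hi]
  have hrange : ∀ z : Fin n → Fin N, (∀ i : Fin n, ¬ i.val < k → G.Adj c (z i)) →
      ∃ s : Fin n → Fin d, z = prependWord (fun i : Fin k => z (i.castLE hk)) (e ∘ s) :=
      fun z hz => by
    have : ∀ i : Fin n, ∃ j : Fin d, ¬ i.val < k → e j = z i := fun i => by
      by_cases hi : i.val < k
      · exact ⟨⟨0, hd⟩, fun h => absurd hi h⟩
      · obtain ⟨j, hj⟩ := he _ (hz i hi)
        exact ⟨j, fun _ => hj⟩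
    choose s hs using this
    refine ⟨s, funext fun i => ?_⟩
    by_cases hi : i.val < k
    · simp [prependWord, hi]
    · simp [prependWord, hi, hs i hi]
  cases t with
  | true =>
    have hx : ∀ i : Fin n, ¬ i.val < k → x i = c := fun i hi => by
      simpa using htx i (hpre i hi)
    obtain ⟨s, hs⟩ := hrange y fun i hi => hx i hi ▸ hadj i (hpre i hi)
    rw [hconst x hx, hs] at hpQ
    exact Set.mem_iUnion.2 ⟨(true, _, _, s), by simpa only [starSquare, if_true] using hpQ⟩
  | false =>
    have hy : ∀ i : Fin n, ¬ i.val < k → y i = c := fun i hi => by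
      simpa using hty i (hpre i hi)
    obtain ⟨s, hs⟩ := hrange x fun i hi => hy i hi ▸ (hadj i (hpre i hi)).symm
    rw [hconst y hy, hs] at hpQ
    exact Set.mem_iUnion.2 ⟨(false, _, _, s), by
      simpa only [starSquare, Bool.false_eq_true, if_false] using hpQ⟩

theorem ediam_starSquare_le (c : Fin N) {d : ℕ} (e : Fin d → Fin N) (k n : ℕ)
    (q : Bool × (Fin k → Fin N) × (Fin k → Fin N) × (Fin n → Fin d)) :
    Metric.ediam (starSquare c e k n q) ≤ ENNReal.ofReal ((N : ℝ) ^ n)⁻¹ := by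
  rw [starSquare]
  split_ifs <;> exact ediam_Qset_le _ _

theorem dimH_LamInf_offDiag_le (G : SimpleGraph (Fin N)) (c : Fin N) {d : ℕ} (hd : 0 < d)
    (hN : 1 < N) (e : Fin d → Fin N) (he : ∀ b, G.Adj c b → b ∈ Set.range e) (k : ℕ) :
    dimH {p ∈ LamInf G {c} | 3 * ((N : ℝ) ^ k)⁻¹ < |p.1 - p.2|} ≤
      ENNReal.ofReal (Real.log d / Real.log N) := by
  have hN' : (1 : ℝ) < N := by exact_mod_cast hN
  have hd' : (0 : ℝ) < d := by exact_mod_cast hd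
  have hr : 0 ≤ Real.log d / Real.log N := by positivity
  refine dimH_le_of_hausdorffMeasure_ne_top (ne_top_of_le_ne_top (b := 2 * (N : ENNReal) ^ k *
    (N : ENNReal) ^ k) (by finiteness) ?_)
  rw [Real.coe_toNNReal _ hr]
  refine (Measure.hausdorffMeasure_le_liminf_sum (l := Filter.atTop) _ _
    (fun n : ℕ => ENNReal.ofReal ((N : ℝ) ^ n)⁻¹) ?_ (starSquare c e k)
    (.of_forall fun n q => ediam_starSquare_le c e k n q) ?_).trans ?_
  · rw [← ENNReal.ofReal_zero]
    refine (ENNReal.continuous_ofReal.tendsto 0).comp ?_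
    simp_rw [← inv_pow]
    exact tendsto_pow_atTop_nhds_zero_of_lt_one (by positivity) (inv_lt_one_of_one_lt₀ hN')
  · filter_upwards [Filter.eventually_ge_atTop k, Filter.eventually_ge_atTop 1] with n hk hn p hp
    exact mem_iUnion_starSquare G c hd e he hk (Set.mem_iInter₂.1 hp.1 n hn) hp.2
  · rw [← Filter.liminf_const (f := Filter.atTop (α := ℕ))
      (2 * (N : ENNReal) ^ k * (N : ENNReal) ^ k)]
    refine Filter.liminf_le_liminf (.of_forall fun n => ?_)
    calc ∑ q, Metric.ediam (starSquare c e k n q) ^ (Real.log d / Real.log N)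
        ≤ ∑ q : Bool × (Fin k → Fin N) × (Fin k → Fin N) × (Fin n → Fin d),
            ENNReal.ofReal ((d : ℝ) ^ n)⁻¹ := by
          refine sum_le_sum fun q _ => ?_
          rw [← inv_pow_rpow_log_div_log hd hN, ← ENNReal.ofReal_rpow_of_nonneg (by positivity) hr]
          exact ENNReal.rpow_le_rpow (ediam_starSquare_le c e k n q) hr
      _ = 2 * (N : ENNReal) ^ k * (N : ENNReal) ^ k *
            ((d : ENNReal) ^ n * ENNReal.ofReal ((d : ℝ) ^ n)⁻¹) := by
          simp [mul_assoc]
      _ = 2 * (N : ENNReal) ^ k * (N : ENNReal) ^ k := by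
          have : (d : ENNReal) ^ n = ENNReal.ofReal ((d : ℝ) ^ n) := by
            rw [ENNReal.ofReal_pow hd'.le, ENNReal.ofReal_natCast]
          rw [this, ← ENNReal.ofReal_mul (by positivity), mul_inv_cancel₀ (by positivity),
            ENNReal.ofReal_one, mul_one]

theorem fst_mem_Icc_of_mem_LamInf (G : SimpleGraph (Fin N)) (V1 : Finset (Fin N)) {p : ℝ × ℝ}
    (hp : p ∈ LamInf G V1) : p.1 ∈ Set.Icc (0 : ℝ) 1 := by
  obtain ⟨⟨x, y⟩, -, ⟨h1, h2⟩, -⟩ := Set.mem_iUnion₂.1 (Set.mem_iInter₂.1 hp 1 le_rfl)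
  have hN : (0 : ℝ) < N := Nat.cast_pos.2 (Fin.pos (x 0))
  have hx : ((x 0 : ℕ) : ℝ) + 1 ≤ N := by exact_mod_cast (x 0).isLt
  simp only [Ipt, univ_unique, Fin.default_eq_zero, sum_singleton, Fin.val_zero, zero_add,
    pow_one, ← add_div] at h1 h2
  exact ⟨le_trans (by positivity) h1, h2.trans ((div_le_one hN).2 hx)⟩

theorem dimH_LamInf_diff_DiagSet_le (G : SimpleGraph (Fin N)) (c : Fin N) {d : ℕ} (hd : 0 < d)
    (hN : 1 < N) (e : Fin d → Fin N) (he : ∀ b, G.Adj c b → b ∈ Set.range e) :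
    dimH (LamInf G {c} \ DiagSet) ≤ ENNReal.ofReal (Real.log d / Real.log N) := by
  have hN' : (1 : ℝ) < N := by exact_mod_cast hN
  refine (dimH_mono (t := ⋃ k : ℕ,
    {p ∈ LamInf G {c} | 3 * ((N : ℝ) ^ k)⁻¹ < |p.1 - p.2|}) ?_).trans ?_
  · rintro p ⟨hp, hpd⟩
    have hne : 0 < |p.1 - p.2| := abs_pos.2 (sub_ne_zero.2 fun h =>
      hpd ⟨p.1, fst_mem_Icc_of_mem_LamInf G _ hp, Prod.ext rfl h⟩)
    obtain ⟨k, hk⟩ := exists_pow_lt_of_lt_one (div_pos hne three_pos) (inv_lt_one_of_one_lt₀ hN')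
    rw [inv_pow] at hk
    exact Set.mem_iUnion.2 ⟨k, hp, by linarith⟩
  · rw [dimH_iUnion]
    exact iSup_le fun k => dimH_LamInf_offDiag_le G c hd hN e he k

theorem le_dimH_LamInf_diff_DiagSet (G : SimpleGraph (Fin N)) (c : Fin N) {d : ℕ} (hd : 1 < d)
    {e : Fin d → Fin N} (he : StrictMono e) (hadj : ∀ i, G.Adj c (e i)) :
    ENNReal.ofReal (Real.log d / Real.log N) ≤ dimH (LamInf G {c} \ DiagSet) := by
  refine (log_div_log_le_dimH_range_ofDigits hd he).trans ?_
  refine (dimH_mono (t := {Real.ofDigits fun _ => c} ∪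
    Prod.snd '' (LamInf G {c} \ DiagSet)) ?_).trans ?_
  · rintro _ ⟨a, rfl⟩
    by_cases h : Real.ofDigits (e ∘ a) = Real.ofDigits fun _ => c
    · exact Or.inl h
    · refine Or.inr ⟨(_, _), ⟨mem_LamInf_of_adj G c (e ∘ a) fun i => hadj _, ?_⟩, rfl⟩
      rintro ⟨t, -, ht⟩
      rw [Prod.mk.injEq] at ht
      exact h (ht.2.symm.trans ht.1)
  · rw [dimH_union, dimH_singleton, max_eq_right zero_le]
    exact LipschitzWith.prod_snd.dimH_image_le _

theorem dimH_LamInf_diff_DiagSet (G : SimpleGraph (Fin N)) (c : Fin N) (hd : 1 < degH G c) :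
    dimH (LamInf G {c} \ DiagSet) =
      ENNReal.ofReal (Real.log (degH G c) / Real.log N) := by
  set S := univ.filter fun w => G.Adj c w with hS
  have hcard : S.card = degH G c := rfl
  have hN : 1 < N := hd.trans_le (by simpa [← hcard] using S.card_le_univ)
  refine le_antisymm ?_ ?_
  · refine dimH_LamInf_diff_DiagSet_le G c (by omega) hN (S.orderEmbOfFin hcard) fun b hb => ?_
    rw [range_orderEmbOfFin]
    simpa [hS] using hb
  · refine le_dimH_LamInf_diff_DiagSet G c hd (S.orderEmbOfFin hcard).strictMono fun i => ?_
    exact (mem_filter.1 (S.orderEmbOfFin_mem hcard i)).2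

/-- if `n₁ = 1` then (A1) holds with `d₁ = |E(G)|` and
`γ̃ = log N / log|E(G)| = 1 / dim_H(Λ \ Diag)`. -/
theorem statement8 {N : ℕ} (G : SimpleGraph (Fin N)) (V1 : Finset (Fin N))
    (hV1 : V1.Nonempty) (hV2 : V1ᶜ.Nonempty)
    (hbip : ∀ a b : Fin N, G.Adj a b → (a ∈ V1 ↔ b ∉ V1))
    (hE : G.edgeFinset.Nonempty)
    (d₁ d₂ : ℕ) (hd1 : ∀ a ∈ V1, degH G a = d₁) (hd2 : ∀ b ∈ V1ᶜ, degH G b ≤ d₂)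
    (hd21 : d₂ ≤ d₁ - 1) (hn1 : V1.card = 1) :
    ((∀ a ∈ V1, degH G a = G.edgeFinset.card) ∧
        ∀ b ∈ V1ᶜ, degH G b ≤ G.edgeFinset.card - 1) ∧
      Real.log ((N : ℝ) / (V1.card : ℝ)) / Real.log (d₁ : ℝ)
          = Real.log (N : ℝ) / Real.log (G.edgeFinset.card : ℝ) ∧
        Real.log (N : ℝ) / Real.log (G.edgeFinset.card : ℝ)
          = ((dimH (LamInf G V1 \ DiagSet)).toReal)⁻¹ := by
  obtain ⟨c, rfl⟩ := card_eq_one.1 hn1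
  have hinc : ∀ a b, G.Adj a b → a = c ∨ b = c := fun a b h => by
    have := hbip a b h
    simp only [mem_singleton] at this
    tauto
  have hdeg : degH G c = d₁ := hd1 c (mem_singleton_self c)
  have hcard : G.edgeFinset.card = d₁ := (card_edgeFinset_eq_degH G c hinc).trans hdeg
  have hd₁ : 1 < d₁ := by
    obtain ⟨b, hb⟩ : (univ.filter fun w => G.Adj c w).Nonempty := by
      rw [← card_pos]
      exact hE.card_pos.trans_eq (hcard.trans hdeg.symm)
    have hcb : G.Adj c b := (mem_filter.1 hb).2
    have h1 : 0 < degH G b := card_pos.2 ⟨c, mem_filter.2 ⟨mem_univ c, hcb.symm⟩⟩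
    have h2 := hd2 b (by simpa using hcb.ne')
    omega
  refine ⟨⟨fun a ha => (hd1 a ha).trans hcard.symm, fun b hb => ?_⟩, ?_, ?_⟩
  · rw [hcard]
    exact (hd2 b hb).trans hd21
  · rw [hcard, hn1, Nat.cast_one, div_one]
  · rw [hcard, dimH_LamInf_diff_DiagSet G c (hdeg ▸ hd₁), hdeg,
      ENNReal.toReal_ofReal (by positivity), inv_div]

end HierGraph
end
end
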